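/- arXiv:1606.06428 — 2 statements merged into one kernel-verified Lean document; each statement's English description precedes it below -/
import Mathlib

section
/- The ring K = R[x]/⟨f(x)^{p^s} + u g(x)⟩ is a chain ring with unique maximal ideal ⟨f(x)⟩, and its ideals are precisely the principal ideals ⟨f(x)^i⟩ for 0 ≤ i ≤ 2p^s, forming a strictly decreasing chain K = ⟨1⟩ ⊋ ⟨f⟩ ⊋ ⋯ ⊋ ⟨f^{2p^s − 1}⟩ ⊋ ⟨f^{2p^s}⟩ = ⟨0⟩. -/
open Polynomial

/-- The ring `K = R[x]/⟨f(x)^{p^s} + u g(x)⟩`, where `R = F + uF = DualNumber F` and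
`u = DualNumber.eps` (so `u² = 0`); it is realized as an `AdjoinRoot`, which is by
definition the quotient ring `R[x] ⧸ ⟨f^{p^s} + u g⟩`. -/
noncomputable abbrev Kring (F : Type) [Field F] (ps : ℕ) (f g : F[X]) : Type :=
  AdjoinRoot ((f.map (algebraMap F (DualNumber F))) ^ ps +
    C DualNumber.eps * g.map (algebraMap F (DualNumber F)))

/-- The natural projection `R[x] → K`. -/
noncomputable abbrev kMk (F : Type) [Field F] (ps : ℕ) (f g : F[X]) :
    (DualNumber F)[X] →+* Kring F ps f g :=
  AdjoinRoot.mk _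

/-! ### Chain rings from a nilpotent generator of the non-units -/

section ChainRing

variable {A : Type*} [CommRing A] {e : A} {n : ℕ}

theorem exists_associated_pow (hn : e ^ n = 0) (h : ∀ a : A, IsUnit a ∨ e ∣ a) (a : A) :
    ∃ i ≤ n, Associated a (e ^ i) := by
  have key : ∀ k ≤ n, (∃ i ≤ n, Associated a (e ^ i)) ∨ e ^ k ∣ a := by
    intro k
    induction k with
    | zero => simp
    | succ k ih =>
      intro hk
      rcases ih (by omega) with h' | ⟨c, rfl⟩
      · exact Or.inl h'
      rcases h c with hc | hc
      · exact Or.inl ⟨k, by omega, associated_mul_unit_left _ _ hc⟩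
      · exact Or.inr (pow_succ e k ▸ mul_dvd_mul_left _ hc)
  rcases key n le_rfl with h' | h'
  · exact h'
  · rw [hn, zero_dvd_iff] at h'
    exact ⟨n, le_rfl, by rw [h', hn]⟩

theorem ideal_eq_span_pow (hn : e ^ n = 0) (h : ∀ a : A, IsUnit a ∨ e ∣ a) (I : Ideal A) :
    ∃ i ≤ n, I = Ideal.span {e ^ i} := by
  classical
  have hex : ∃ i, e ^ i ∈ I := ⟨n, hn ▸ I.zero_mem⟩
  refine ⟨Nat.find hex, Nat.find_min' hex (hn ▸ I.zero_mem), le_antisymm (fun a ha => ?_) ?_⟩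
  · obtain ⟨j, -, hj⟩ := exists_associated_pow hn h a
    exact Ideal.mem_span_singleton.2 <|
      (pow_dvd_pow e (Nat.find_min' hex (I.mem_of_dvd hj.dvd ha))).trans hj.symm.dvd
  · exact (Ideal.span_singleton_le_iff_mem I).2 (Nat.find_spec hex)

theorem span_pow_lt_span_pow (hn : e ^ n = 0) (hn' : e ^ (n - 1) ≠ 0) {i j : ℕ}
    (hj : j ≤ n) (hij : i < j) : Ideal.span {e ^ j} < Ideal.span {e ^ i} := by
  refine lt_of_le_not_ge (Ideal.span_singleton_le_span_singleton.2 (pow_dvd_pow e hij.le)) ?_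
  rw [Ideal.span_singleton_le_span_singleton]
  rintro ⟨c, hc⟩
  apply hn'
  rw [show n - 1 = i + (n - 1 - i) by omega, pow_add, hc, mul_right_comm, ← pow_add,
    pow_eq_zero_of_le (by omega) hn, zero_mul]

theorem isMaximal_span_of_isUnit_or_dvd [Nontrivial A] (hn : e ^ n = 0)
    (h : ∀ a : A, IsUnit a ∨ e ∣ a) : (Ideal.span {e}).IsMaximal := by
  refine ⟨⟨?_, fun J hJ => ?_⟩⟩
  · rw [Ne, Ideal.span_singleton_eq_top]
    exact IsNilpotent.not_isUnit ⟨n, hn⟩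
  · obtain ⟨a, haJ, ha⟩ := SetLike.exists_of_lt hJ
    exact J.eq_top_of_isUnit_mem haJ
      ((h a).resolve_right fun hd => ha (Ideal.mem_span_singleton.2 hd))

theorem eq_span_of_isMaximal (hn : e ^ n = 0) (hmax : (Ideal.span {e}).IsMaximal)
    (I : Ideal A) (hI : I.IsMaximal) : I = Ideal.span {e} :=
  (hmax.eq_of_le hI.ne_top <| (Ideal.span_singleton_le_iff_mem I).2 <|
    hI.isPrime.mem_of_pow_mem n (hn ▸ I.zero_mem)).symm

end ChainRing

/-! ### The ring `K` -/

section Kring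

variable {F : Type} [Field F]

theorem eps_dvd_sub_inl_fst (a : DualNumber F) :
    DualNumber.eps ∣ a - algebraMap F (DualNumber F) a.fst :=
  ⟨algebraMap F (DualNumber F) a.snd, by
    ext <;> simp [TrivSqZeroExt.algebraMap_eq_inl]⟩

theorem exists_eq_map_add_eps_mul (P : (DualNumber F)[X]) :
    ∃ (P₀ : F[X]) (Q : (DualNumber F)[X]),
      P = P₀.map (algebraMap F (DualNumber F)) + C DualNumber.eps * Q := by
  let φ : DualNumber F →+* F := (TrivSqZeroExt.fstHom F F F).toRingHom
  have h : C DualNumber.eps ∣ P - (P.map φ).map (algebraMap F (DualNumber F)) := by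
    rw [C_dvd_iff_dvd_coeff]
    intro i
    rw [coeff_sub, coeff_map, coeff_map]
    exact eps_dvd_sub_inl_fst _
  obtain ⟨Q, hQ⟩ := h
  exact ⟨P.map φ, Q, by rw [← hQ]; ring⟩

theorem isUnit_map_of_isCoprime {A B : Type*} [CommRing A] [CommRing B] (ψ : A →+* B) {a b : A}
    (h : IsCoprime a b) (ha : IsNilpotent (ψ a)) : IsUnit (ψ b) := by
  obtain ⟨c, d, hcd⟩ := h
  have hcd' : ψ d * ψ b = 1 - ψ c * ψ a := by
    rw [eq_sub_iff_add_eq', ← map_mul, ← map_mul, ← map_add, hcd, map_one]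
  refine isUnit_of_mul_isUnit_right (x := ψ d) ?_
  rw [hcd']
  exact ((Commute.all _ _).isNilpotent_mul_left ha).isUnit_one_sub

variable (N : ℕ) (f g : F[X])

/-- The map `F[x] → K` induced by `F ⊆ R`. -/
noncomputable def kOfPoly : F[X] →+* Kring F N f g :=
  (kMk F N f g).comp (mapRingHom (algebraMap F (DualNumber F)))

theorem kOfPoly_pow :
    kOfPoly N f g f ^ N = -(kMk F N f g (C DualNumber.eps) * kOfPoly N f g g) := by
  rw [eq_neg_iff_add_eq_zero, kOfPoly, RingHom.comp_apply, RingHom.comp_apply, ← map_pow,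
    ← map_mul, ← map_add]
  exact AdjoinRoot.mk_self

theorem kMk_eps_mul_self : kMk F N f g (C DualNumber.eps) * kMk F N f g (C DualNumber.eps) = 0 := by
  rw [← map_mul, ← C_mul, DualNumber.eps_mul_eps, C_0, map_zero]

theorem kOfPoly_pow_two_mul : kOfPoly N f g f ^ (2 * N) = 0 := by
  rw [mul_comm, pow_mul, kOfPoly_pow, neg_sq, mul_pow, sq (kMk F N f g _), kMk_eps_mul_self,
    zero_mul]

variable {N f g}

theorem isUnit_or_kOfPoly_dvd (hN : 0 < N) (hirr : Irreducible f) (hcop : IsCoprime f g)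
    (a : Kring F N f g) : IsUnit a ∨ kOfPoly N f g f ∣ a := by
  have hnil : IsNilpotent (kOfPoly N f g f) := ⟨_, kOfPoly_pow_two_mul N f g⟩
  obtain ⟨P, rfl⟩ := AdjoinRoot.mk_surjective a
  obtain ⟨P₀, Q, rfl⟩ := exists_eq_map_add_eps_mul P
  rw [map_add, map_mul]
  by_cases hd : f ∣ P₀
  · right
    refine dvd_add (map_dvd (kOfPoly N f g) hd) (Dvd.dvd.mul_right ?_ _)
    rw [← (isUnit_map_of_isCoprime (kOfPoly N f g) hcop hnil).dvd_mul_right, ← dvd_neg]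
    exact (dvd_pow_self _ hN.ne').trans (kOfPoly_pow N f g).dvd
  · left
    have hu : IsUnit (kOfPoly N f g P₀) :=
      isUnit_map_of_isCoprime _ (hirr.coprime_iff_not_dvd.2 hd) hnil
    have hε : IsNilpotent (kMk F N f g (C DualNumber.eps)) :=
      ⟨2, by rw [sq, kMk_eps_mul_self]⟩
    exact IsNilpotent.isUnit_add_left_of_commute
      ((Commute.all _ _).isNilpotent_mul_right hε) hu (Commute.all _ _)

/-- Sending `u` to `-f ^ N * g⁻¹` maps `K` to `F[x]/⟨f ^ (2 * N)⟩`. -/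
theorem exists_kring_hom (hcop : IsCoprime f g) :
    ∃ Φ : Kring F N f g →+* AdjoinRoot (f ^ (2 * N)),
      ∀ q, Φ (kOfPoly N f g q) = AdjoinRoot.mk (f ^ (2 * N)) q := by
  let π := AdjoinRoot.mk (f ^ (2 * N))
  have hf : π f ^ (2 * N) = 0 := by rw [← map_pow]; exact AdjoinRoot.mk_self
  obtain ⟨c, hc⟩ := (isUnit_map_of_isCoprime π hcop ⟨_, hf⟩).exists_left_inv
  have hsq : (-(π f ^ N * c)) * (-(π f ^ N * c)) = 0 := by
    linear_combination c ^ 2 * hf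
  let φ : DualNumber F →ₐ[F] AdjoinRoot (f ^ (2 * N)) :=
    DualNumber.lift ⟨(Algebra.ofId F _, -(π f ^ N * c)), hsq, fun _ => Commute.all _ _⟩
  have hφ : φ DualNumber.eps = -(π f ^ N * c) := DualNumber.lift_apply_eps _
  have hmap : ∀ q : F[X], (q.map (algebraMap F (DualNumber F))).eval₂ φ.toRingHom
      (AdjoinRoot.root (f ^ (2 * N))) = π q := by
    intro q
    rw [eval₂_map, AlgHom.toRingHom_eq_coe, AlgHom.comp_algebraMap]
    exact AdjoinRoot.aeval_eq q
  refine ⟨AdjoinRoot.lift φ.toRingHom (AdjoinRoot.root _) ?_, fun q => ?_⟩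
  · rw [eval₂_add, eval₂_pow, eval₂_mul, hmap, hmap, eval₂_C]
    change π f ^ N + φ DualNumber.eps * π g = 0
    rw [hφ]
    linear_combination -(π f ^ N) * hc
  · exact (AdjoinRoot.lift_mk _ _).trans (hmap q)

theorem kOfPoly_pow_ne_zero (hN : 0 < N) (hirr : Irreducible f) (hcop : IsCoprime f g) :
    kOfPoly N f g f ^ (2 * N - 1) ≠ 0 := by
  obtain ⟨Φ, hΦ⟩ := exists_kring_hom (N := N) hcop
  intro h
  have h0 := congrArg Φ h
  rw [map_pow, hΦ, map_zero, ← map_pow, AdjoinRoot.mk_eq_zero,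
    pow_dvd_pow_iff hirr.ne_zero hirr.not_isUnit] at h0
  omega

end Kring

/-- Let `f ∈ F[x]` be monic irreducible of degree `d ≥ 1` and `g ∈ F[x]`
nonzero and coprime to `f`. Then `K = R[x]/⟨f(x)^{p^s} + u g(x)⟩` is a chain ring: its
ideals are linearly ordered by inclusion; `⟨f⟩` is its unique maximal ideal; its ideals are
precisely the `⟨f^i⟩` for `0 ≤ i ≤ 2p^s`, which form a strictly decreasing chain from
`⟨1⟩ = K` down to `⟨f^{2p^s}⟩ = ⟨0⟩`. -/
theorem stmt_14 (p m s : ℕ) (hp : p.Prime) (hm : 0 < m) (hs : 0 < s)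
    (F : Type) [Field F] [Fintype F] (hF : Fintype.card F = p ^ m)
    (f g : F[X]) (hmon : f.Monic) (hirr : Irreducible f) (hd : 1 ≤ f.natDegree)
    (hg : g ≠ 0) (hcop : IsCoprime f g)
    (e : Kring F (p ^ s) f g)
    (he : e = kMk F (p ^ s) f g (f.map (algebraMap F (DualNumber F)))) :
    (∀ I J : Ideal (Kring F (p ^ s) f g), I ≤ J ∨ J ≤ I) ∧
    (Ideal.span {e}).IsMaximal ∧
    (∀ I : Ideal (Kring F (p ^ s) f g), I.IsMaximal → I = Ideal.span {e}) ∧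
    (∀ I : Ideal (Kring F (p ^ s) f g), ∃ i ≤ 2 * p ^ s, I = Ideal.span {e ^ i}) ∧
    (∀ i j : ℕ, i ≤ 2 * p ^ s → j ≤ 2 * p ^ s → i < j →
      Ideal.span {e ^ j} < Ideal.span {e ^ i}) ∧
    Ideal.span {e ^ (2 * p ^ s)} = (⊥ : Ideal (Kring F (p ^ s) f g)) := by
  have hN : 0 < p ^ s := pow_pos hp.pos s
  replace he : e = kOfPoly (p ^ s) f g f := he
  have hn : e ^ (2 * p ^ s) = 0 := he ▸ kOfPoly_pow_two_mul _ f g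
  have hn' : e ^ (2 * p ^ s - 1) ≠ 0 := he ▸ kOfPoly_pow_ne_zero hN hirr hcop
  have h : ∀ a, IsUnit a ∨ e ∣ a := he ▸ isUnit_or_kOfPoly_dvd hN hirr hcop
  have : Nontrivial (Kring F (p ^ s) f g) := ⟨_, _, hn'⟩
  have hmax := isMaximal_span_of_isUnit_or_dvd hn h
  refine ⟨fun I J => ?_, hmax, eq_span_of_isMaximal hn hmax, ideal_eq_span_pow hn h,
    fun i j _ hj hij => span_pow_lt_span_pow hn hn' hj hij, by simp [hn]⟩
  obtain ⟨i, -, rfl⟩ := ideal_eq_span_pow hn h I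
  obtain ⟨j, -, rfl⟩ := ideal_eq_span_pow hn h J
  simp only [Ideal.span_singleton_le_span_singleton]
  exact (le_total j i).imp (pow_dvd_pow e) (pow_dvd_pow e)
end

section
/- Let a = (a_0, …, a_{np^s−1}) and b = (b_0, …, b_{np^s−1}) be vectors in R^{np^s}, and let a(x) = Σ a_i x^i and b(x) = Σ b_i x^i be the corresponding polynomials. Let τ(a(x)) denote the element of 𝓡̂ = R[x]/⟨x^{np^s} − (α + uβ)^{-1}⟩ obtained by substituting x ↦ x^{-1} = (α + uβ)x^{np^s − 1} into a(x), i.e., τ(a(x)) = Σ_i a_i ((α + uβ)x^{np^s−1})^i in 𝓡̂. If τ(a(x))·b(x) = 0 in 𝓡̂, then the inner product a·b = Σ_{i=0}^{np^s−1} a_i b_i equals 0 in R. -/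
open Polynomial

/-- `α + uβ` as an element of `R = F + uF = DualNumber F`
(where `u = DualNumber.eps` satisfies `u² = 0`). -/
noncomputable def lamAdd (F : Type) [Field F] (α β : F) : DualNumber F :=
  algebraMap F (DualNumber F) α + DualNumber.eps * algebraMap F (DualNumber F) β

/-- The ambient ring `R[x]/⟨x^N − l⟩`, realized as `AdjoinRoot (X^N - C l)`,
which is by definition the quotient ring `R[x] ⧸ ⟨X^N - C l⟩`. -/
noncomputable abbrev Amb (F : Type) [Field F] (N : ℕ) (l : DualNumber F) : Type :=
  AdjoinRoot ((X : (DualNumber F)[X]) ^ N - C l)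

/-- The natural projection `R[x] → R[x]/⟨x^N − l⟩`. -/
noncomputable abbrev ambMk (F : Type) [Field F] (N : ℕ) (l : DualNumber F) :
    (DualNumber F)[X] →+* Amb F N l :=
  AdjoinRoot.mk _

/-- The polynomial `∑ c_i x^i` associated with a vector `c ∈ R^N`. -/
noncomputable def toPoly {A : Type} [CommRing A] {N : ℕ} (c : Fin N → A) : A[X] :=
  ∑ i, Polynomial.C (c i) * X ^ (i : ℕ)

/-- The code in `R^N` corresponding to an ideal `I` of `R[x]/⟨x^N − l⟩`: the set of
coefficient vectors `c ∈ R^N` (coefficients of the unique representative of degree `< N`)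
whose associated polynomial class lies in `I`. -/
noncomputable def codeOf (F : Type) [Field F] (N : ℕ) (l : DualNumber F)
    (I : Ideal (Amb F N l)) : Set (Fin N → DualNumber F) :=
  {c | ambMk F N l (toPoly c) ∈ I}

/-- The dual code `C^⊥ = {a ∈ R^N | a·b = 0 for all b ∈ C}`, where `a·b = ∑ aᵢbᵢ`. -/
def dualCode {A : Type} [CommRing A] {N : ℕ} (S : Set (Fin N → A)) : Set (Fin N → A) :=
  {a | ∀ b ∈ S, ∑ i, a i * b i = 0}

/-- `(α + uβ)⁻¹ = α⁻¹ − u α⁻² β` as an element of `R = F + uF = DualNumber F`. -/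
noncomputable def lamInv (F : Type) [Field F] (α β : F) : DualNumber F :=
  algebraMap F (DualNumber F) α⁻¹ - DualNumber.eps * algebraMap F (DualNumber F) (α⁻¹ ^ 2 * β)

/-- For `k < N`, the constant coefficient of the representative of `x ^ k` in `A[x]/⟨x^N - l⟩`. -/
theorem coeff_zero_modByMonicHom_root_pow {A : Type} [CommRing A] [Nontrivial A] {N : ℕ} {l : A}
    (hg : (X ^ N - C l : A[X]).Monic) (hN : 0 < N) {k : ℕ} (hk : k < N) :
    (AdjoinRoot.modByMonicHom hg (AdjoinRoot.root (X ^ N - C l) ^ k)).coeff 0 =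
      if k = 0 then 1 else 0 := by
  rw [← AdjoinRoot.mk_X, ← map_pow, AdjoinRoot.modByMonicHom_mk,
    (modByMonic_eq_self_iff hg).2, coeff_X_pow]
  · simp only [eq_comm]
  · rw [degree_X_pow, degree_X_pow_sub_C hN]
    exact_mod_cast hk

/-- In `A[x]/⟨x^N - l⟩` with `v * l = 1`, the constant coefficients of the products
`(v x^(N-1))^i * x^j`, where `i, j < N`, are given by the Kronecker delta. -/
theorem coeff_zero_modByMonicHom_inv_pow_mul_root_pow {A : Type} [CommRing A] [Nontrivial A]
    {N : ℕ} {l v : A} (hv : v * l = 1) (hg : (X ^ N - C l : A[X]).Monic) (i j : Fin N) :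
    (AdjoinRoot.modByMonicHom hg
      (AdjoinRoot.mk (X ^ N - C l) (C v * X ^ (N - 1)) ^ (i : ℕ) *
        AdjoinRoot.root (X ^ N - C l) ^ (j : ℕ))).coeff 0 = if i = j then 1 else 0 := by
  obtain ⟨i, hi⟩ := i
  obtain ⟨j, hj⟩ := j
  have hN : 0 < N := by omega
  simp only [Fin.mk.injEq]
  set x := AdjoinRoot.root (X ^ N - C l) with hx
  set y := AdjoinRoot.mk (X ^ N - C l) (C v * X ^ (N - 1)) with hy
  have hxN : x ^ N = AdjoinRoot.of (X ^ N - C l) l := by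
    have h := AdjoinRoot.mk_self (f := X ^ N - C l)
    rwa [map_sub, map_pow, AdjoinRoot.mk_X, AdjoinRoot.mk_C, sub_eq_zero] at h
  have hvx : AdjoinRoot.of (X ^ N - C l) v * x ^ N = 1 := by
    rw [hxN, ← map_mul, hv, map_one]
  have hyx : y * x = 1 := by
    rw [hy, map_mul, map_pow, AdjoinRoot.mk_X, AdjoinRoot.mk_C, mul_assoc, ← hx,
      pow_sub_one_mul hN.ne', hvx]
  have hpow (k : ℕ) : y ^ k * x ^ k = 1 := by rw [← mul_pow, hyx, one_pow]
  rcases le_or_gt i j with hij | hij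
  · obtain ⟨d, rfl⟩ := Nat.exists_eq_add_of_le hij
    rw [pow_add, ← mul_assoc, hpow, one_mul,
      coeff_zero_modByMonicHom_root_pow hg hN (by omega)]
    simp
  · have hprod : y ^ i * x ^ j = v • x ^ (N - (i - j)) := by
      obtain ⟨d, rfl⟩ := Nat.exists_eq_add_of_lt hij
      obtain ⟨e, rfl⟩ := Nat.exists_eq_add_of_le (show d + 1 ≤ N by omega)
      have hsub : d + 1 + e - (j + d + 1 - j) = e := by omega
      rw [hsub, Algebra.smul_def, AdjoinRoot.algebraMap_eq]
      calc y ^ (j + d + 1) * x ^ j = y ^ (d + 1) * (y ^ j * x ^ j) := by ring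
        _ = y ^ (d + 1) * (AdjoinRoot.of (X ^ (d + 1 + e) - C l) v * x ^ (d + 1 + e)) := by
          rw [hpow, hvx]
        _ = y ^ (d + 1) * x ^ (d + 1) * (AdjoinRoot.of (X ^ (d + 1 + e) - C l) v * x ^ e) := by
          ring
        _ = _ := by rw [hpow, one_mul]
    rw [hprod, map_smul, coeff_smul, coeff_zero_modByMonicHom_root_pow hg hN (by omega),
      if_neg (by omega), if_neg (by omega), smul_zero]

/-- `Σ aᵢ bᵢ` is the constant coefficient of `a(x⁻¹) b(x)` in `A[x]/⟨x^N - l⟩`,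
where `x⁻¹ = v x^(N-1)` and `v * l = 1`. -/
theorem coeff_zero_modByMonicHom_reciprocal_mul {A : Type} [CommRing A] [Nontrivial A]
    {N : ℕ} {l v : A} (hv : v * l = 1) (hg : (X ^ N - C l : A[X]).Monic) (a b : Fin N → A) :
    (AdjoinRoot.modByMonicHom hg
      ((∑ i, AdjoinRoot.mk (X ^ N - C l) (C (a i)) *
          AdjoinRoot.mk (X ^ N - C l) (C v * X ^ (N - 1)) ^ (i : ℕ)) *
        AdjoinRoot.mk (X ^ N - C l) (toPoly b))).coeff 0 = ∑ i, a i * b i := by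
  have hsmul (i j : Fin N) (y z : AdjoinRoot (X ^ N - C l)) :
      AdjoinRoot.of (X ^ N - C l) (a i) * y * (AdjoinRoot.of (X ^ N - C l) (b j) * z) =
        (a i * b j) • (y * z) := by
    rw [Algebra.smul_def, AdjoinRoot.algebraMap_eq, map_mul]
    ring
  simp only [toPoly, map_sum, map_mul _ (C (b _)), map_pow _ X, AdjoinRoot.mk_X,
    AdjoinRoot.mk_C, Finset.sum_mul_sum, hsmul, map_smul, finsetSum_coeff, coeff_smul,
    coeff_zero_modByMonicHom_inv_pow_mul_root_pow hv hg]
  simp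

theorem lamAdd_mul_lamInv (F : Type) [Field F] {α : F} (hα : α ≠ 0) (β : F) :
    lamAdd F α β * lamInv F α β = 1 := by
  ext
  · simp [lamAdd, lamInv, TrivSqZeroExt.algebraMap_eq_inl, hα]
  · simp [lamAdd, lamInv, TrivSqZeroExt.algebraMap_eq_inl]
    field_simp
    ring

/-- Let `𝓡̂ = R[x]/⟨x^{np^s} - (α + uβ)⁻¹⟩`, where
`(α + uβ)⁻¹ = α⁻¹ - uα⁻²β`, and in `𝓡̂` let `x⁻¹ = (α + uβ)x^{np^s - 1}`. For vectors
`a, b ∈ R^{np^s}` with associated polynomials `a(x) = Σ aᵢxⁱ`, `b(x) = Σ bᵢxⁱ`, let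
`τ(a(x)) = Σᵢ aᵢ ((α + uβ)x^{np^s−1})ⁱ` in `𝓡̂`. If `τ(a(x))·b(x) = 0` in `𝓡̂`, then
the inner product `a·b = Σ aᵢbᵢ` equals `0` in `R`. -/
theorem stmt_18 (p m n s : ℕ) (hp : p.Prime) (hm : 0 < m) (hn : 0 < n) (hs : 0 < s)
    (hnp : Nat.gcd n p = 1)
    (F : Type) [Field F] [Fintype F] (hF : Fintype.card F = p ^ m)
    (α β : F) (hα : α ≠ 0) (hβ : β ≠ 0) :
    ∀ a b : Fin (n * p ^ s) → DualNumber F,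
      (∑ i : Fin (n * p ^ s),
          ambMk F (n * p ^ s) (lamInv F α β) (C (a i)) *
            ambMk F (n * p ^ s) (lamInv F α β)
              (C (lamAdd F α β) * X ^ (n * p ^ s - 1)) ^ (i : ℕ)) *
        ambMk F (n * p ^ s) (lamInv F α β) (toPoly b) = 0 →
      ∑ i, a i * b i = 0 := by
  intro a b h
  have hN : n * p ^ s ≠ 0 := mul_ne_zero hn.ne' (pow_ne_zero _ hp.ne_zero)
  have hsum := coeff_zero_modByMonicHom_reciprocal_mul (lamAdd_mul_lamInv F hα β)
    (monic_X_pow_sub_C (lamInv F α β) hN) a b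
  rw [← hsum, h, map_zero, coeff_zero]
end
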